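/- Let u : ℝ² → ℝ² be smooth, compactly supported away from the origin, with vanishing zeroth angular Fourier mode on every circle. Then the homogeneous H¹ seminorm satisfies ‖u‖_{Ḣ¹(ℝ²)} ≤ C‖∂_θ u‖_{Ḣ¹(ℝ²)} for an absolute constant C, where the gradient in polar coordinates is (∂_r, r⁻¹∂_θ). -/

import Mathlib

open Real MeasureTheory

noncomputable def aDv (u : ℝ × ℝ → ℝ × ℝ) (x : ℝ × ℝ) : ℝ × ℝ :=
  x.1 • fderiv ℝ u x (0, 1) - x.2 • fderiv ℝ u x (1, 0)

/-- Squared pointwise gradient of a planar vector field (sum over all first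
partial derivatives of all components). -/
noncomputable def grad2 (u : ℝ × ℝ → ℝ × ℝ) (x : ℝ × ℝ) : ℝ :=
  (fderiv ℝ u x (1, 0)).1 ^ 2 + (fderiv ℝ u x (1, 0)).2 ^ 2 +
    (fderiv ℝ u x (0, 1)).1 ^ 2 + (fderiv ℝ u x (0, 1)).2 ^ 2

/-- The squared length of the gradient of a planar scalar field. -/
noncomputable def gradSq (w : ℝ × ℝ → ℝ) (x : ℝ × ℝ) : ℝ :=
  fderiv ℝ w x (1, 0) ^ 2 + fderiv ℝ w x (0, 1) ^ 2

/-- The angular derivative `x₁∂₂ - x₂∂₁` of a planar scalar field. -/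
noncomputable def angularDeriv (w : ℝ × ℝ → ℝ) (x : ℝ × ℝ) : ℝ :=
  fderiv ℝ w x (-x.2, x.1)

/-- Cauchy–Schwarz against the constant function on an interval. -/
theorem sq_intervalIntegral_abs_le {f : ℝ → ℝ} (hf : Continuous f) {a b : ℝ} (hab : a < b) :
    (∫ t in a..b, |f t|) ^ 2 ≤ (b - a) * ∫ t in a..b, f t ^ 2 := by
  set I := ∫ t in a..b, |f t| with hI
  have hnonneg : 0 ≤ ∫ t in a..b, ((b - a) * |f t| - I) ^ 2 :=
    intervalIntegral.integral_nonneg hab.le fun t _ => sq_nonneg _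
  have hexpand : ∫ t in a..b, ((b - a) * |f t| - I) ^ 2
      = (b - a) ^ 2 * (∫ t in a..b, f t ^ 2) - 2 * (b - a) * I * I + (b - a) * I ^ 2 := by
    have hpt : ∀ t, ((b - a) * |f t| - I) ^ 2
        = (b - a) ^ 2 * f t ^ 2 - 2 * (b - a) * I * |f t| + I ^ 2 := by
      intro t
      rw [← sq_abs (f t)]
      ring
    simp_rw [hpt]
    rw [intervalIntegral.integral_add, intervalIntegral.integral_sub,
      intervalIntegral.integral_const_mul, intervalIntegral.integral_const_mul,
      intervalIntegral.integral_const, ← hI, smul_eq_mul]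
    all_goals exact Continuous.intervalIntegrable (by fun_prop) _ _
  rw [hexpand] at hnonneg
  have hpos : 0 < b - a := sub_pos.2 hab
  nlinarith

/-- Poincaré inequality on an interval for functions of mean zero. -/
theorem intervalIntegral_sq_le_of_integral_eq_zero {f f' : ℝ → ℝ} (hf' : Continuous f')
    (hderiv : ∀ t, HasDerivAt f (f' t) t) {a b : ℝ} (hab : a < b)
    (hmean : ∫ t in a..b, f t = 0) :
    ∫ t in a..b, f t ^ 2 ≤ (b - a) ^ 2 * ∫ t in a..b, f' t ^ 2 := by
  have hf : Continuous f := continuous_iff_continuousAt.2 fun t => (hderiv t).continuousAt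
  obtain ⟨c, hc, hfc⟩ := exists_eq_interval_average hab.ne hf.continuousOn
  have hfc : f c = 0 := by rw [hfc, interval_average_eq, hmean, smul_zero]
  rw [Set.uIoo_of_le hab.le] at hc
  have hbound : ∀ t ∈ Set.Icc a b, f t ^ 2 ≤ (b - a) * ∫ s in a..b, f' s ^ 2 := by
    intro t ht
    refine le_trans ?_ (sq_intervalIntegral_abs_le hf' hab)
    have hftc : ∫ s in c..t, f' s = f t := by
      rw [intervalIntegral.integral_eq_sub_of_hasDerivAt (fun s _ => hderiv s)
        (hf'.intervalIntegrable _ _), hfc, sub_zero]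
    rw [← hftc, ← sq_abs]
    have hle : |∫ s in c..t, f' s| ≤ ∫ s in a..b, |f' s| := by
      refine (intervalIntegral.norm_integral_le_abs_integral_norm (f := f')).trans ?_
      rw [← abs_of_nonneg (intervalIntegral.integral_nonneg hab.le fun s _ => abs_nonneg (f' s))]
      refine intervalIntegral.abs_integral_mono_interval ?_ ?_ (hf'.abs.intervalIntegrable _ _)
      · rw [Set.uIoc_of_le hab.le]
        exact Set.Ioc_subset_Ioc (le_min hc.1.le ht.1) (max_le hc.2.le ht.2)
      · exact Filter.Eventually.of_forall fun s => abs_nonneg (f' s)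
    gcongr
  calc ∫ t in a..b, f t ^ 2
      ≤ ∫ _ in a..b, (b - a) * ∫ s in a..b, f' s ^ 2 :=
        intervalIntegral.integral_mono_on hab.le ((hf.pow 2).intervalIntegrable _ _)
          (continuous_const.intervalIntegrable _ _) hbound
    _ = (b - a) ^ 2 * ∫ t in a..b, f' t ^ 2 := by
        rw [intervalIntegral.integral_const, smul_eq_mul]
        ring

/-- Differentiation under an interval integral of a jointly continuous family. -/
theorem hasDerivAt_intervalIntegral_of_continuous {F F' : ℝ → ℝ → ℝ}
    (hF : Continuous (Function.uncurry F)) (hF' : Continuous (Function.uncurry F'))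
    (hderiv : ∀ r t, HasDerivAt (fun ρ => F ρ t) (F' r t) r) (a b r : ℝ) :
    HasDerivAt (fun ρ => ∫ t in a..b, F ρ t) (∫ t in a..b, F' r t) r := by
  obtain ⟨M, hM⟩ := ((isCompact_closedBall r 1).prod (isCompact_uIcc (a := a) (b := b)))
    |>.exists_bound_of_continuousOn hF'.continuousOn
  refine (intervalIntegral.hasDerivAt_integral_of_dominated_loc_of_deriv_le (bound := fun _ => M)
    (Metric.closedBall_mem_nhds r one_pos) ?_ ?_ ?_ ?_ ?_ ?_).2
  · exact Filter.Eventually.of_forall fun ρ =>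
      (hF.comp (Continuous.prodMk_right ρ)).aestronglyMeasurable
  · exact (hF.comp (Continuous.prodMk_right r)).intervalIntegrable _ _
  · exact (hF'.comp (Continuous.prodMk_right r)).aestronglyMeasurable
  · exact Filter.Eventually.of_forall fun t ht ρ hρ =>
      hM (ρ, t) ⟨hρ, Set.uIoc_subset_uIcc ht⟩
  · exact continuous_const.intervalIntegrable _ _
  · exact Filter.Eventually.of_forall fun t _ ρ _ => hderiv ρ t

theorem gradSq_eq_polar (w : ℝ × ℝ → ℝ) (x : ℝ × ℝ) (θ : ℝ) :
    gradSq w x = fderiv ℝ w x (cos θ, sin θ) ^ 2 + fderiv ℝ w x (-sin θ, cos θ) ^ 2 := by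
  have hlin : ∀ p q : ℝ, fderiv ℝ w x (p, q)
      = p * fderiv ℝ w x (1, 0) + q * fderiv ℝ w x (0, 1) := by
    intro p q
    have : ((p, q) : ℝ × ℝ) = p • (1, 0) + q • (0, 1) := by simp
    rw [this, map_add, map_smul, map_smul, smul_eq_mul, smul_eq_mul]
  rw [hlin (cos θ), hlin (-sin θ), gradSq]
  linear_combination (-(fderiv ℝ w x (1, 0) ^ 2 + fderiv ℝ w x (0, 1) ^ 2)) * sin_sq_add_cos_sq θ

theorem continuous_gradSq {w : ℝ × ℝ → ℝ} (hw : ContDiff ℝ 1 w) : Continuous (gradSq w) := by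
  have := hw.continuous_fderiv one_ne_zero
  unfold gradSq
  fun_prop

theorem contDiff_angularDeriv {w : ℝ × ℝ → ℝ} (hw : ContDiff ℝ 2 w) :
    ContDiff ℝ 1 (angularDeriv w) := by
  have : ContDiff ℝ 1 (fderiv ℝ w) := hw.fderiv_right (by norm_num)
  unfold angularDeriv
  fun_prop

theorem fderiv_angularDeriv {w : ℝ × ℝ → ℝ} (hw : ContDiff ℝ 2 w) (x v : ℝ × ℝ) :
    fderiv ℝ (angularDeriv w) x v
      = fderiv ℝ (fderiv ℝ w) x (-x.2, x.1) v + fderiv ℝ w x (-v.2, v.1) := by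
  have hdiff : DifferentiableAt ℝ (fderiv ℝ w) x :=
    (hw.fderiv_right (m := 1) (by norm_num)).differentiable one_ne_zero x
  have hrot : HasFDerivAt (fun y : ℝ × ℝ => (-y.2, y.1))
      ((-ContinuousLinearMap.snd ℝ ℝ ℝ).prod (ContinuousLinearMap.fst ℝ ℝ ℝ)) x :=
    hasFDerivAt_snd.neg.prodMk hasFDerivAt_fst
  have h := (hdiff.hasFDerivAt.clm_apply hrot).fderiv
  have hsymm : IsSymmSndFDerivAt ℝ w x := hw.contDiffAt.isSymmSndFDerivAt (by simp)
  have h' : fderiv ℝ (angularDeriv w) x = _ := h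
  rw [h', hsymm.eq]
  simp [add_comm]

/-- Differentiating along a circle a directional derivative whose direction rotates with the
point commutes with the angular derivative. -/
theorem hasDerivAt_fderiv_circle {w : ℝ × ℝ → ℝ} (hw : ContDiff ℝ 2 w) (r : ℝ)
    {v : ℝ → ℝ × ℝ} (hv : ∀ θ, HasDerivAt v (-(v θ).2, (v θ).1) θ) (θ : ℝ) :
    HasDerivAt (fun t => fderiv ℝ w (r * cos t, r * sin t) (v t))
      (fderiv ℝ (angularDeriv w) (r * cos θ, r * sin θ) (v θ)) θ := by
  have hdiff : Differentiable ℝ (fderiv ℝ w) :=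
    (hw.fderiv_right (m := 1) (by norm_num)).differentiable one_ne_zero
  have hcircle : HasDerivAt (fun t => (r * cos t, r * sin t)) (-(r * sin θ), r * cos θ) θ := by
    have := ((hasDerivAt_cos θ).const_mul r).prodMk ((hasDerivAt_sin θ).const_mul r)
    simpa using this
  have h := ((hdiff _).hasFDerivAt.comp_hasDerivAt θ hcircle).clm_apply (hv θ)
  rw [fderiv_angularDeriv hw]
  exact h

/-- Poincaré inequality on a circle for the full gradient. -/
theorem integral_gradSq_circle_le {w : ℝ × ℝ → ℝ} (hw : ContDiff ℝ 2 w)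
    (hmean : ∀ r : ℝ, 0 < r → ∫ θ in (0 : ℝ)..(2 * π), w (r * cos θ, r * sin θ) = 0)
    {r : ℝ} (hr : 0 < r) :
    ∫ θ in (0 : ℝ)..(2 * π), gradSq w (r * cos θ, r * sin θ)
      ≤ (2 * π) ^ 2 *
        ∫ θ in (0 : ℝ)..(2 * π), gradSq (angularDeriv w) (r * cos θ, r * sin θ) := by
  have hw1 : ContDiff ℝ 1 w := hw.of_le (by norm_num)
  have hDw : Continuous (fderiv ℝ w) := hw1.continuous_fderiv one_ne_zero
  have hDa : Continuous (fderiv ℝ (angularDeriv w)) :=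
    (contDiff_angularDeriv hw).continuous_fderiv one_ne_zero
  have hwc : Continuous w := hw.continuous
  have hwd : Differentiable ℝ w := hw1.differentiable one_ne_zero
  have hradial : ∫ θ in (0 : ℝ)..(2 * π), fderiv ℝ w (r * cos θ, r * sin θ) (cos θ, sin θ) = 0 := by
    have hD := hasDerivAt_intervalIntegral_of_continuous
      (F := fun ρ θ => w (ρ * cos θ, ρ * sin θ))
      (F' := fun ρ θ => fderiv ℝ w (ρ * cos θ, ρ * sin θ) (cos θ, sin θ))
      (by unfold Function.uncurry; fun_prop) (by unfold Function.uncurry; fun_prop)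
      (fun ρ θ => by
        have hray : HasDerivAt (fun s : ℝ => (s * cos θ, s * sin θ)) (cos θ, sin θ) ρ := by
          have := ((hasDerivAt_id ρ).mul_const (cos θ)).prodMk
            ((hasDerivAt_id ρ).mul_const (sin θ))
          simpa using this
        exact (hwd _).hasFDerivAt.comp_hasDerivAt ρ hray)
      0 (2 * π) r
    refine hD.unique ((hasDerivAt_const r (0 : ℝ)).congr_of_eventuallyEq ?_)
    filter_upwards [lt_mem_nhds hr] with ρ hρ using hmean ρ hρ
  have hangular :
      ∫ θ in (0 : ℝ)..(2 * π), fderiv ℝ w (r * cos θ, r * sin θ) (-sin θ, cos θ) = 0 := by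
    have hderiv : ∀ θ, HasDerivAt (fun t => w (r * cos t, r * sin t))
        (r * fderiv ℝ w (r * cos θ, r * sin θ) (-sin θ, cos θ)) θ := by
      intro θ
      have hcircle := ((hasDerivAt_cos θ).const_mul r).prodMk ((hasDerivAt_sin θ).const_mul r)
      have h := (hwd (r * cos θ, r * sin θ)).hasFDerivAt.comp_hasDerivAt θ hcircle
      rw [← smul_eq_mul, ← map_smul]
      exact h
    have h := intervalIntegral.integral_eq_sub_of_hasDerivAt (a := 0) (b := 2 * π)
      (fun θ _ => hderiv θ) (Continuous.intervalIntegrable (by fun_prop) _ _)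
    rw [intervalIntegral.integral_const_mul] at h
    simpa [hr.ne'] using h
  have hpoincare_radial := intervalIntegral_sq_le_of_integral_eq_zero (by fun_prop)
    (hasDerivAt_fderiv_circle hw r (v := fun θ => (cos θ, sin θ))
      fun θ => (hasDerivAt_cos θ).prodMk (hasDerivAt_sin θ)) two_pi_pos hradial
  have hpoincare_angular := intervalIntegral_sq_le_of_integral_eq_zero (by fun_prop)
    (hasDerivAt_fderiv_circle hw r (v := fun θ => (-sin θ, cos θ))
      fun θ => (hasDerivAt_sin θ).neg.prodMk (hasDerivAt_cos θ)) two_pi_pos hangular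
  have hsplit : ∀ {z : ℝ × ℝ → ℝ}, Continuous (fderiv ℝ z) →
      ∫ θ in (0 : ℝ)..(2 * π), gradSq z (r * cos θ, r * sin θ)
        = (∫ θ in (0 : ℝ)..(2 * π), fderiv ℝ z (r * cos θ, r * sin θ) (cos θ, sin θ) ^ 2)
          + ∫ θ in (0 : ℝ)..(2 * π), fderiv ℝ z (r * cos θ, r * sin θ) (-sin θ, cos θ) ^ 2 := by
    intro z hz
    rw [← intervalIntegral.integral_add (Continuous.intervalIntegrable (by fun_prop) _ _)
      (Continuous.intervalIntegrable (by fun_prop) _ _)]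
    exact intervalIntegral.integral_congr fun θ _ => gradSq_eq_polar z _ θ
  rw [hsplit hDw, hsplit hDa, mul_add]
  rw [sub_zero] at hpoincare_radial hpoincare_angular
  exact add_le_add hpoincare_radial hpoincare_angular

theorem integrableOn_polarCoord_target {f : ℝ × ℝ → ℝ} (hf : Continuous f)
    (hsupp : HasCompactSupport f) :
    IntegrableOn (fun p : ℝ × ℝ => p.1 * f (p.1 * cos p.2, p.1 * sin p.2))
      (Set.Ioi (0 : ℝ) ×ˢ Set.Ioo (-π) π) := by
  obtain ⟨R, hR⟩ := hsupp.isCompact.isBounded.subset_closedBall (0 : ℝ × ℝ)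
  have hzero : ∀ p : ℝ × ℝ, 2 * R < p.1 → f (p.1 * cos p.2, p.1 * sin p.2) = 0 := by
    intro p hp
    by_contra hne
    have hmem := hR (subset_tsupport f hne)
    rw [mem_closedBall_zero_iff, Prod.norm_def, max_le_iff, Real.norm_eq_abs, Real.norm_eq_abs]
      at hmem
    have hR0 : 0 ≤ R := (abs_nonneg _).trans hmem.1
    have h1 := sq_le_sq' (abs_le.1 hmem.1).1 (abs_le.1 hmem.1).2
    have h2 := sq_le_sq' (abs_le.1 hmem.2).1 (abs_le.1 hmem.2).2
    have h3 : (p.1 * cos p.2) ^ 2 + (p.1 * sin p.2) ^ 2 = p.1 ^ 2 := by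
      linear_combination p.1 ^ 2 * sin_sq_add_cos_sq p.2
    nlinarith
  have hcont : Continuous fun p : ℝ × ℝ => p.1 * f (p.1 * cos p.2, p.1 * sin p.2) := by fun_prop
  have hcompact : IsCompact (Set.Icc (0 : ℝ) (2 * R) ×ˢ Set.Icc (-π) π) :=
    isCompact_Icc.prod isCompact_Icc
  refine (hcont.continuousOn.integrableOn_compact hcompact).of_forall_sdiff_eq_zero
    (measurableSet_Ioi.prod measurableSet_Ioo) ?_
  rintro ⟨s, θ⟩ ⟨⟨hs, hθ⟩, hout⟩
  have hsR : 2 * R < s := by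
    by_contra hle
    exact hout ⟨⟨le_of_lt hs, not_lt.1 hle⟩, Set.Ioo_subset_Icc_self hθ⟩
  simp only [hzero (s, θ) hsR, mul_zero]

theorem integral_Ioo_circle (f : ℝ × ℝ → ℝ) (r : ℝ) :
    ∫ θ in Set.Ioo (-π) π, f (r * cos θ, r * sin θ)
      = ∫ θ in (0 : ℝ)..(2 * π), f (r * cos θ, r * sin θ) := by
  have hper : Function.Periodic (fun θ => f (r * cos θ, r * sin θ)) (2 * π) := fun θ => by simp
  have hshift := hper.intervalIntegral_add_eq (-π) 0
  rw [zero_add, show -π + 2 * π = π by ring] at hshift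
  rw [← hshift, intervalIntegral.integral_of_le (by linarith [pi_pos]),
    integral_Ioc_eq_integral_Ioo]

theorem integral_eq_integral_circle {f : ℝ × ℝ → ℝ} (hf : Continuous f)
    (hsupp : HasCompactSupport f) :
    ∫ x, f x
      = ∫ r in Set.Ioi (0 : ℝ), r * ∫ θ in (0 : ℝ)..(2 * π), f (r * cos θ, r * sin θ) := by
  have hint := integrableOn_polarCoord_target hf hsupp
  rw [← integral_comp_polarCoord_symm]
  simp only [polarCoord_target, polarCoord_symm_apply, smul_eq_mul]
  rw [Measure.volume_eq_prod] at hint ⊢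
  rw [setIntegral_prod _ hint]
  refine setIntegral_congr_fun measurableSet_Ioi fun r _ => ?_
  simp only [integral_const_mul, integral_Ioo_circle]

theorem integrableOn_integral_circle {f : ℝ × ℝ → ℝ} (hf : Continuous f)
    (hsupp : HasCompactSupport f) :
    IntegrableOn (fun r => r * ∫ θ in (0 : ℝ)..(2 * π), f (r * cos θ, r * sin θ))
      (Set.Ioi (0 : ℝ)) := by
  have hint := integrableOn_polarCoord_target hf hsupp
  rw [IntegrableOn, Measure.volume_eq_prod, ← Measure.prod_restrict] at hint
  refine hint.integral_prod_left.congr (Filter.Eventually.of_forall fun r => ?_)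
  simp only [integral_const_mul, integral_Ioo_circle]

theorem hasCompactSupport_gradSq {w : ℝ × ℝ → ℝ} (hw : HasCompactSupport w) :
    HasCompactSupport (gradSq w) :=
  (hw.fderiv (𝕜 := ℝ)).comp_left
    (g := fun L : ℝ × ℝ →L[ℝ] ℝ => L (1, 0) ^ 2 + L (0, 1) ^ 2) (by simp)

theorem hasCompactSupport_angularDeriv {w : ℝ × ℝ → ℝ} (hw : HasCompactSupport w) :
    HasCompactSupport (angularDeriv w) :=
  (hw.fderiv (𝕜 := ℝ)).mono fun x hx h => hx (by simp [angularDeriv, h])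

theorem integrable_gradSq {w : ℝ × ℝ → ℝ} (hw : ContDiff ℝ 1 w) (hsupp : HasCompactSupport w) :
    Integrable (gradSq w) :=
  (continuous_gradSq hw).integrable_of_hasCompactSupport (hasCompactSupport_gradSq hsupp)

/-- Scalar form of the `Ḣ¹` Poincaré inequality for fields of angular mean zero. -/
theorem integral_gradSq_le {w : ℝ × ℝ → ℝ} (hw : ContDiff ℝ 2 w) (hsupp : HasCompactSupport w)
    (hmean : ∀ r : ℝ, 0 < r → ∫ θ in (0 : ℝ)..(2 * π), w (r * cos θ, r * sin θ) = 0) :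
    ∫ x, gradSq w x ≤ (2 * π) ^ 2 * ∫ x, gradSq (angularDeriv w) x := by
  have hc := continuous_gradSq (hw.of_le (by norm_num))
  have hs := hasCompactSupport_gradSq hsupp
  have hca := continuous_gradSq (contDiff_angularDeriv hw)
  have hsa := hasCompactSupport_gradSq (hasCompactSupport_angularDeriv hsupp)
  rw [integral_eq_integral_circle hc hs, integral_eq_integral_circle hca hsa,
    ← integral_const_mul]
  refine setIntegral_mono_on (integrableOn_integral_circle hc hs)
    ((integrableOn_integral_circle hca hsa).const_mul _) measurableSet_Ioi fun r hr => ?_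
  rw [mul_left_comm]
  exact mul_le_mul_of_nonneg_left (integral_gradSq_circle_le hw hmean hr) (le_of_lt hr)

theorem fderiv_functional_comp_apply {w : ℝ × ℝ → ℝ × ℝ} (L : ℝ × ℝ →L[ℝ] ℝ) {x : ℝ × ℝ}
    (hw : DifferentiableAt ℝ w x) (v : ℝ × ℝ) :
    fderiv ℝ (fun y => L (w y)) x v = L (fderiv ℝ w x v) := by
  have h : fderiv ℝ (fun y => L (w y)) x = _ := (L.hasFDerivAt.comp x hw.hasFDerivAt).fderiv
  rw [h, ContinuousLinearMap.comp_apply]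

theorem angularDeriv_clm_comp {u : ℝ × ℝ → ℝ × ℝ} (hu : Differentiable ℝ u)
    (L : ℝ × ℝ →L[ℝ] ℝ) : angularDeriv (fun y => L (u y)) = fun y => L (aDv u y) := by
  funext x
  have hx : ((-x.2, x.1) : ℝ × ℝ) = x.1 • (0, 1) - x.2 • (1, 0) := by simp
  rw [angularDeriv, fderiv_functional_comp_apply L (hu x), aDv, hx, map_sub, map_smul, map_smul]

theorem grad2_eq {u : ℝ × ℝ → ℝ × ℝ} (hu : Differentiable ℝ u) (x : ℝ × ℝ) :
    grad2 u x = gradSq (fun y => ContinuousLinearMap.fst ℝ ℝ ℝ (u y)) x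
      + gradSq (fun y => ContinuousLinearMap.snd ℝ ℝ ℝ (u y)) x := by
  simp only [grad2, gradSq, fderiv_functional_comp_apply _ (hu x)]
  simp only [ContinuousLinearMap.coe_fst', ContinuousLinearMap.coe_snd']
  ring

theorem contDiff_aDv {u : ℝ × ℝ → ℝ × ℝ} (hu : ContDiff ℝ 2 u) : ContDiff ℝ 1 (aDv u) := by
  have : ContDiff ℝ 1 (fderiv ℝ u) := hu.fderiv_right (by norm_num)
  unfold aDv
  fun_prop

theorem integral_grad2_le {u : ℝ × ℝ → ℝ × ℝ} (hu : ContDiff ℝ 2 u) (hsupp : HasCompactSupport u)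
    (hmean : ∀ r : ℝ, 0 < r → ∫ θ in (0 : ℝ)..(2 * π), u (r * cos θ, r * sin θ) = 0) :
    ∫ x, grad2 u x ≤ (2 * π) ^ 2 * ∫ x, grad2 (aDv u) x := by
  have hud : Differentiable ℝ u := hu.differentiable two_ne_zero
  have hsmooth (L : ℝ × ℝ →L[ℝ] ℝ) : ContDiff ℝ 2 fun y => L (u y) := L.contDiff.comp hu
  have hcompact (L : ℝ × ℝ →L[ℝ] ℝ) : HasCompactSupport fun y => L (u y) :=
    hsupp.comp_left (map_zero L)
  have hcomp (L : ℝ × ℝ →L[ℝ] ℝ) := integral_gradSq_le (hsmooth L) (hcompact L) fun r hr => by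
    rw [L.intervalIntegral_comp_comm, hmean r hr, map_zero]
    have := hu.continuous
    exact Continuous.intervalIntegrable (by fun_prop) _ _
  have hint (L : ℝ × ℝ →L[ℝ] ℝ) : Integrable (gradSq fun y => L (u y)) :=
    integrable_gradSq ((hsmooth L).of_le (by norm_num)) (hcompact L)
  have hinta (L : ℝ × ℝ →L[ℝ] ℝ) : Integrable (gradSq fun y => L (aDv u y)) := by
    rw [← angularDeriv_clm_comp hud L]
    exact integrable_gradSq (contDiff_angularDeriv (hsmooth L))
      (hasCompactSupport_angularDeriv (hcompact L))
  simp_rw [grad2_eq hud, grad2_eq ((contDiff_aDv hu).differentiable one_ne_zero)]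
  rw [integral_add (hint _) (hint _), integral_add (hinta _) (hinta _), mul_add]
  simp_rw [angularDeriv_clm_comp hud] at hcomp
  exact add_le_add (hcomp _) (hcomp _)

/-- Ḣ¹ Poincaré inequality: for smooth u compactly supported away from the origin
with vanishing zeroth angular mode on every circle, ‖u‖_{Ḣ¹} ≤ C ‖∂_θ u‖_{Ḣ¹}. -/
theorem stmt5 :
    ∃ C : ℝ, 0 < C ∧ ∀ u : ℝ × ℝ → ℝ × ℝ,
      ContDiff ℝ (⊤ : ℕ∞) u → HasCompactSupport u → (0, 0) ∉ tsupport u →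
      (∀ r : ℝ, 0 < r → ∫ θ in (0 : ℝ)..(2 * π), u (r * cos θ, r * sin θ) = 0) →
      Real.sqrt (∫ x : ℝ × ℝ, grad2 u x)
        ≤ C * Real.sqrt (∫ x : ℝ × ℝ, grad2 (aDv u) x) := by
  refine ⟨2 * π, two_pi_pos, fun u hu hsupp _ hmean => ?_⟩
  rw [← sqrt_sq two_pi_pos.le, ← sqrt_mul (sq_nonneg _)]
  exact sqrt_le_sqrt
    (integral_grad2_le (hu.of_le (WithTop.coe_le_coe.2 le_top)) hsupp hmean)
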